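/- Let μ > 4π. Define W'_μ := {(z₁,z₂,z₃) ∈ ℂ³ : z₂ ≠ 0, z₃ ≠ 0, |z₁ − exp(i·log|z₂z₃|²)| < 1, −μ < log|z₂|² < μ, −μ < log|z₃|² < μ} and Ŵ'_μ := W'_μ ∪ ⋃_{−μ/2 < a < μ/2 − 2π} {(z₁,z₂,z₃) ∈ ℂ³ : |z₁ − e^{2ia}| < 1, a < log|z₂|² < a + 2π, a < log|z₃|² < a + 2π}. Suppose Y ⊆ ℂ³ is open, the closure of W'_μ is contained in Y, and f : ℂ³ → ℂ is holomorphic on Y. Then there exists F : ℂ³ → ℂ holomorphic on Ŵ'_μ such that F = f on W'_μ. -/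

import Mathlib

open Complex

/-- `log|z₂z₃|²` as a real number. -/
noncomputable def Lofz (z : ℂ × ℂ × ℂ) : ℝ :=
  Real.log (‖z.2.1 * z.2.2‖ ^ 2)

/-- The truncated worm `W'_μ`. -/
noncomputable def wormTrunc (μ : ℝ) : Set (ℂ × ℂ × ℂ) :=
  {z | z.2.1 ≠ 0 ∧ z.2.2 ≠ 0 ∧
    ‖z.1 - Complex.exp (Complex.I * (Lofz z : ℂ))‖ < 1 ∧
    -μ < Real.log (‖z.2.1‖ ^ 2) ∧ Real.log (‖z.2.1‖ ^ 2) < μ ∧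
    -μ < Real.log (‖z.2.2‖ ^ 2) ∧ Real.log (‖z.2.2‖ ^ 2) < μ}

/-- The enlargement `Ŵ'_μ` of `W'_μ`, obtained by attaching the sets
`Δ_a × 𝒜_a × 𝒜_a` for `a ∈ (−μ/2, μ/2 − 2π)`. -/
noncomputable def wormHat (μ : ℝ) : Set (ℂ × ℂ × ℂ) :=
  wormTrunc μ ∪
    ⋃ a ∈ Set.Ioo (-μ / 2) (μ / 2 - 2 * Real.pi),
      {z : ℂ × ℂ × ℂ |
        ‖z.1 - Complex.exp (2 * Complex.I * (a : ℂ))‖ < 1 ∧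
        z.2.1 ≠ 0 ∧ a < Real.log (‖z.2.1‖ ^ 2) ∧
          Real.log (‖z.2.1‖ ^ 2) < a + 2 * Real.pi ∧
        z.2.2 ≠ 0 ∧ a < Real.log (‖z.2.2‖ ^ 2) ∧
          Real.log (‖z.2.2‖ ^ 2) < a + 2 * Real.pi}

open Filter Topology Set Metric MeasureTheory in
lemma aux_fderiv_cont {E : Type*} [NormedAddCommGroup E] [NormedSpace ℂ E] [FiniteDimensional ℂ E]
    {U : Set E} (hU : IsOpen U) {f : E → ℂ} (hf : DifferentiableOn ℂ f U) :
    ContinuousOn (fderiv ℂ f) U := by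
  rw [continuousOn_clm_apply]
  intro v x hx
  apply ContinuousAt.continuousWithinAt
  have hc : Continuous (fun q : E × ℂ => q.1 + q.2 • v) := by fun_prop
  have hev : ∀ᶠ q : E × ℂ in 𝓝 x ×ˢ 𝓝 (0:ℂ), q.1 + q.2 • v ∈ U := by
    rw [← nhds_prod_eq]
    apply hc.continuousAt.eventually_mem
    apply hU.mem_nhds
    simpa using hx
  obtain ⟨S, hS, T, hT, hST⟩ := Filter.mem_prod_iff.1 hev
  obtain ⟨δ, hδ, hδT⟩ := Metric.mem_nhds_iff.1 hT
  have hxS : x ∈ S := mem_of_mem_nhds hS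
  have hdiff : ∀ y ∈ S, DifferentiableOn ℂ (fun t : ℂ => f (y + t • v)) (ball 0 δ) := by
    intro y hy t ht
    have hmem : y + t • v ∈ U := hST (Set.mk_mem_prod hy (hδT ht))
    have h1 : DifferentiableAt ℂ f (y + t • v) := (hf _ hmem).differentiableAt (hU.mem_nhds hmem)
    have h2 : DifferentiableAt ℂ (fun t : ℂ => y + t • v) t := by fun_prop
    exact (DifferentiableAt.comp t h1 h2).differentiableWithinAt
  have hder : ∀ y ∈ S, deriv (fun t : ℂ => f (y + t • v)) 0 = fderiv ℂ f y v := by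
    intro y hy
    have hmem : y + (0:ℂ) • v ∈ U := hST (Set.mk_mem_prod hy (hδT (mem_ball_self hδ)))
    have h1 : HasFDerivAt f (fderiv ℂ f y) (y + (0:ℂ) • v) := by
      have := ((hf _ hmem).differentiableAt (hU.mem_nhds hmem)).hasFDerivAt
      simpa using this
    have h2 : HasDerivAt (fun t : ℂ => y + t • v) v 0 := by
      simpa using ((hasDerivAt_id (0:ℂ)).smul_const v).const_add y
    exact (h1.comp_hasDerivAt (0:ℂ) h2).deriv
  have hlu : TendstoLocallyUniformlyOn (fun (y : E) (t : ℂ) => f (y + t • v))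
      (fun t : ℂ => f (x + t • v)) (𝓝 x) (ball 0 δ) := by
    rw [tendstoLocallyUniformlyOn_iff_forall_tendsto]
    intro t ht
    have hmem : x + t • v ∈ U := hST (Set.mk_mem_prod hxS (hδT ht))
    have h1 : ContinuousAt f (x + t • v) := ((hf _ hmem).differentiableAt (hU.mem_nhds hmem)).continuousAt
    have h2 : ContinuousAt (fun q : E × ℂ => f (q.1 + q.2 • v)) (x, t) :=
      ContinuousAt.comp (f := fun q : E × ℂ => q.1 + q.2 • v) h1 hc.continuousAt
    have h3 : ContinuousAt (fun q : E × ℂ => f (x + q.2 • v)) (x, t) :=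
      ContinuousAt.comp (f := fun q : E × ℂ => x + q.2 • v) h1
        (by fun_prop)
    have h4 := (h3.prodMk h2)
    refine Tendsto.mono_right (Tendsto.mono_left h4 ?_) (nhds_le_uniformity _)
    rw [nhds_prod_eq]
    exact Filter.prod_mono le_rfl nhdsWithin_le_nhds
  have := (hlu.deriv (by filter_upwards [hS] with y hy using hdiff y hy) isOpen_ball).tendsto_at
    (mem_ball_self hδ)
  rw [ContinuousAt, ← hder x hxS]
  refine this.congr' ?_
  filter_upwards [hS] with y hy using hder y hy

open Filter Topology Set Metric MeasureTheory in
lemma aux_param {E : Type*} [NormedAddCommGroup E] [NormedSpace ℂ E] [FiniteDimensional ℂ E]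
    {P : Set (E × ℂ)} (hP : IsOpen P) {h : E × ℂ → ℂ} (hh : DifferentiableOn ℂ h P)
    {ρ : ℝ} (hρ : 0 ≤ ρ) (x₀ : E) (hx : ∀ ζ ∈ sphere (0:ℂ) ρ, (x₀, ζ) ∈ P) :
    DifferentiableAt ℂ (fun x => ∮ ζ in C(0, ρ), h (x, ζ)) x₀ := by
  have hcf := aux_fderiv_cont hP hh
  have hK : IsCompact (sphere (0:ℂ) ρ) := isCompact_sphere _ _
  obtain ⟨C, hC⟩ := (isCompact_singleton (x := x₀)).prod hK |>.exists_bound_of_continuousOn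
    (hcf.mono (by rintro ⟨a, b⟩ ⟨ha, hb⟩; simp only [mem_singleton_iff] at ha; subst ha; exact hx b hb))
  have hP' : IsOpen (P ∩ (fderiv ℂ h) ⁻¹' (ball 0 (C+1))) := hcf.isOpen_inter_preimage hP isOpen_ball
  obtain ⟨u, v, hu, hv, hxu, hKv, huv⟩ := generalized_tube_lemma (isCompact_singleton (x := x₀)) hK hP'
    (by rintro ⟨a, b⟩ ⟨ha, hb⟩
        simp only [mem_singleton_iff] at ha; subst ha
        refine ⟨hx b hb, ?_⟩
        have := hC (a, b) ⟨rfl, hb⟩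
        simp only [mem_preimage, mem_ball_zero_iff]; linarith)
  have hxu : x₀ ∈ u := hxu rfl
  have hcm : ∀ θ, circleMap 0 ρ θ ∈ v := fun θ => hKv (circleMap_mem_sphere 0 hρ θ)
  have hcont : ∀ x ∈ u, Continuous (fun θ => deriv (circleMap 0 ρ) θ • h (x, circleMap 0 ρ θ)) := by
    intro x hxx
    have h1 : Continuous (fun θ => h (x, circleMap 0 ρ θ)) := by
      refine hh.continuousOn.comp_continuous (by fun_prop) (fun θ => (huv ⟨hxx, hcm θ⟩).1)
    have h2 : Continuous (deriv (circleMap 0 ρ)) := by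
      have : deriv (circleMap 0 ρ) = fun θ => circleMap 0 ρ θ * I := by
        funext θ; simp
      rw [this]; fun_prop
    exact h2.smul h1
  have := intervalIntegral.hasFDerivAt_integral_of_dominated_of_fderiv_le (𝕜 := ℂ) (μ := volume)
    (a := 0) (b := 2 * Real.pi) (s := u) (x₀ := x₀)
    (F := fun x θ => deriv (circleMap 0 ρ) θ • h (x, circleMap 0 ρ θ))
    (F' := fun x θ => deriv (circleMap 0 ρ) θ •
      (fderiv ℂ h (x, circleMap 0 ρ θ)).comp (ContinuousLinearMap.inl ℂ E ℂ))
    (bound := fun θ => ρ * ((C + 1) * ‖ContinuousLinearMap.inl ℂ E ℂ‖))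
    (hu.mem_nhds hxu)
    (by filter_upwards [hu.mem_nhds hxu] with x hxx using (hcont x hxx).aestronglyMeasurable)
    ((hcont x₀ hxu).intervalIntegrable _ _)
    (by
      have h1 : Continuous (fun θ => fderiv ℂ h (x₀, circleMap 0 ρ θ)) := by
        refine hcf.comp_continuous (by fun_prop) (fun θ => (huv ⟨hxu, hcm θ⟩).1)
      have h2 : Continuous (deriv (circleMap 0 ρ)) := by
        have : deriv (circleMap 0 ρ) = fun θ => circleMap 0 ρ θ * I := by
          funext θ; simp
        rw [this]; fun_prop
      exact (h2.smul (h1.clm_comp continuous_const)).aestronglyMeasurable)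
    (by
      refine Eventually.of_forall fun θ _ x hxx => ?_
      rw [norm_smul]
      have h1 : ‖deriv (circleMap 0 ρ) θ‖ = ρ := by
        simp [abs_of_nonneg hρ]
      rw [h1]
      have h2 := (huv (Set.mk_mem_prod hxx (hcm θ))).2
      simp only [mem_preimage, mem_ball_zero_iff] at h2
      gcongr
      refine (ContinuousLinearMap.opNorm_comp_le _ _).trans ?_
      gcongr)
    (by simp)
    (by
      refine Eventually.of_forall fun θ _ x hxx => ?_
      have h2 := (huv (Set.mk_mem_prod hxx (hcm θ))).1
      have h3 := ((hh _ h2).differentiableAt (hP.mem_nhds h2)).hasFDerivAt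
      have h4 : HasFDerivAt (fun x : E => (x, circleMap 0 ρ θ)) (ContinuousLinearMap.inl ℂ E ℂ) x :=
        hasFDerivAt_prodMk_left x _
      exact HasFDerivAt.const_smul (HasFDerivAt.comp x h3 h4) (deriv (circleMap 0 ρ) θ))
  exact this.differentiableAt

/-- Cauchy operator of an annulus. -/
noncomputable def opC (r R : ℝ) (g : ℂ → ℂ) (w : ℂ) : ℂ :=
  (2 * Real.pi * I)⁻¹ * ((∮ ζ in C(0, R), (ζ - w)⁻¹ * g ζ) - ∮ ζ in C(0, r), (ζ - w)⁻¹ * g ζ)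

open Filter Topology Set Metric MeasureTheory in
lemma aux_opC_diff {E : Type*} [NormedAddCommGroup E] [NormedSpace ℂ E] [FiniteDimensional ℂ E]
    {Y : Set (E × ℂ)} (hY : IsOpen Y) {g : E × ℂ → ℂ} (hg : DifferentiableOn ℂ g Y)
    {r R : ℝ} (hr : 0 ≤ r) (hR : 0 ≤ R) (x₀ : E) (w₀ : ℂ)
    (h1 : ∀ ζ ∈ sphere (0:ℂ) r, (x₀, ζ) ∈ Y) (h2 : ∀ ζ ∈ sphere (0:ℂ) R, (x₀, ζ) ∈ Y)
    (hw1 : ‖w₀‖ ≠ r) (hw2 : ‖w₀‖ ≠ R) :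
    DifferentiableAt ℂ (fun p : E × ℂ => opC r R (fun ζ => g (p.1, ζ)) p.2) (x₀, w₀) := by
  have key : ∀ ρ : ℝ, 0 ≤ ρ → (∀ ζ ∈ sphere (0:ℂ) ρ, (x₀, ζ) ∈ Y) → ‖w₀‖ ≠ ρ →
      DifferentiableAt ℂ (fun p : E × ℂ => ∮ ζ in C(0, ρ), (ζ - p.2)⁻¹ * g (p.1, ζ)) (x₀, w₀) := by
    intro ρ hρ hh hw
    have hc : Continuous (fun q : (E × ℂ) × ℂ => (q.1.1, q.2)) := by fun_prop
    have hd : Continuous (fun q : (E × ℂ) × ℂ => q.2 - q.1.2) := by fun_prop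
    refine aux_param (P := (fun q : (E × ℂ) × ℂ => (q.1.1, q.2)) ⁻¹' Y ∩
        (fun q : (E × ℂ) × ℂ => q.2 - q.1.2) ⁻¹' {0}ᶜ)
      (h := fun q : (E × ℂ) × ℂ => (q.2 - q.1.2)⁻¹ * g (q.1.1, q.2))
      ((hY.preimage hc).inter (isOpen_compl_singleton.preimage hd)) ?_ hρ _ ?_
    · apply DifferentiableOn.mul
      · apply DifferentiableOn.inv (by fun_prop)
        exact fun x hx => hx.2
      · exact hg.comp (f := fun q : (E × ℂ) × ℂ => (q.1.1, q.2)) (by fun_prop) (fun x hx => hx.1)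
    · intro ζ hζ
      refine ⟨hh ζ hζ, ?_⟩
      simp only [mem_preimage, mem_compl_iff, mem_singleton_iff, sub_eq_zero]
      rintro rfl
      exact hw (by simpa using hζ)
  unfold opC
  exact ((key R hR h2 hw2).sub (key r hr h1 hw1)).const_mul _

open Filter Topology Set Metric MeasureTheory in
lemma aux_opC_eq {r R : ℝ} (hr : 0 < r) {g : ℂ → ℂ}
    (hg : ∀ ζ : ℂ, r ≤ ‖ζ‖ → ‖ζ‖ ≤ R → DifferentiableAt ℂ g ζ) {w : ℂ} (h1 : r < ‖w‖) (h2 : ‖w‖ < R) :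
    opC r R g w = g w := by
  have hR : 0 < R := by linarith
  have hd : ∀ ζ : ℂ, r ≤ ‖ζ‖ → ‖ζ‖ ≤ R → ContinuousAt (dslope g w) ζ := by
    intro ζ h3 h4
    by_cases h : ζ = w
    · subst h; exact continuousAt_dslope_same.2 (hg _ h3 h4)
    · exact (continuousAt_dslope_of_ne h).2 (hg _ h3 h4).continuousAt
  have e := circleIntegral_eq_of_differentiable_on_annulus_off_countable (c := 0) hr
    (h1.trans h2).le (f := dslope g w) (s := {w}) (countable_singleton w)
    (by rintro ζ ⟨h3, h4⟩
        simp only [mem_closedBall_zero_iff, mem_ball_zero_iff, not_lt] at h3 h4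
        exact (hd ζ h4 h3).continuousWithinAt)
    (by rintro ζ ⟨⟨h3, h4⟩, h5⟩
        simp only [mem_closedBall_zero_iff, mem_ball_zero_iff, not_le] at h3 h4
        exact (differentiableAt_dslope_of_ne h5).2 (hg ζ h4.le h3.le))
  have hsplit : ∀ ρ : ℝ, r ≤ ρ → ρ ≤ R → ‖w‖ ≠ ρ → (∮ ζ in C(0, ρ), dslope g w ζ) =
      (∮ ζ in C(0, ρ), (ζ - w)⁻¹ * g ζ) - (∮ ζ in C(0, ρ), (ζ - w)⁻¹) * g w := by
    intro ρ h3 h4 h5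
    have hρ : 0 ≤ ρ := by linarith
    have hne : ∀ ζ ∈ sphere (0:ℂ) ρ, ζ ≠ w := by
      rintro ζ hζ rfl; exact h5 (by simpa using hζ)
    have hcinv : ContinuousOn (fun ζ : ℂ => (ζ - w)⁻¹) (sphere 0 ρ) := by
      apply ContinuousOn.inv₀ (by fun_prop)
      exact fun ζ hζ => sub_ne_zero.2 (hne ζ hζ)
    have hcg : ContinuousOn g (sphere 0 ρ) := by
      intro ζ hζ
      have : ‖ζ‖ = ρ := by simpa using hζ
      exact (hg ζ (by linarith) (by linarith)).continuousAt.continuousWithinAt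
    have e2 : (∮ ζ in C(0, ρ), (ζ - w)⁻¹) * g w = ∮ ζ in C(0, ρ), (ζ - w)⁻¹ * g w := by
      rw [mul_comm, ← circleIntegral.integral_const_mul]
      simp_rw [mul_comm]
    rw [e2, ← circleIntegral.integral_sub (f := fun ζ => (ζ - w)⁻¹ * g ζ)
      (g := fun ζ => (ζ - w)⁻¹ * g w) ((hcinv.mul hcg).circleIntegrable hρ)
      ((hcinv.mul continuousOn_const).circleIntegrable hρ)]
    apply circleIntegral.integral_congr hρ
    intro ζ hζ
    simp only
    rw [dslope_of_ne _ (hne ζ hζ), slope_def_field]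
    ring
  have i1 : (∮ ζ in C(0, R), (ζ - w)⁻¹) = 2 * Real.pi * I :=
    circleIntegral.integral_sub_inv_of_mem_ball (by simpa using h2)
  have i2 : (∮ ζ in C(0, r), (ζ - w)⁻¹) = 0 := by
    have hne : ∀ ζ ∈ closedBall (0:ℂ) r, ζ - w ≠ 0 := by
      intro ζ hζ h
      rw [sub_eq_zero] at h; subst h
      simp at hζ; linarith
    apply Complex.circleIntegral_eq_zero_of_differentiable_on_off_countable hr.le countable_empty
    · exact ContinuousOn.inv₀ (by fun_prop) hne
    · rintro ζ ⟨hζ, -⟩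
      exact DifferentiableAt.inv (by fun_prop) (hne ζ (ball_subset_closedBall hζ))
  rw [hsplit R (by linarith) le_rfl h2.ne, hsplit r le_rfl (by linarith) h1.ne', i1, i2] at e
  unfold opC
  have hpi : (2 * Real.pi * I : ℂ) ≠ 0 := by
    simp [Real.pi_ne_zero]
  rw [inv_mul_eq_iff_eq_mul₀ hpi]
  linear_combination e

/-- Cauchy operator in the third variable. -/
noncomputable def opG (r R : ℝ) (f : ℂ × ℂ × ℂ → ℂ) (z : ℂ × ℂ × ℂ) : ℂ :=
  opC r R (fun ζ => f (z.1, z.2.1, ζ)) z.2.2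

/-- Cauchy operator in the second and third variables. -/
noncomputable def opF (r R : ℝ) (f : ℂ × ℂ × ℂ → ℂ) (z : ℂ × ℂ × ℂ) : ℂ :=
  opC r R (fun ζ => opG r R f (z.1, ζ, z.2.2)) z.2.1

open Filter Topology Set Metric in
lemma aux_opF_diff {Y : Set (ℂ × ℂ × ℂ)} (hY : IsOpen Y) {f : ℂ × ℂ × ℂ → ℂ}
    (hf : DifferentiableOn ℂ f Y) {r R : ℝ} (hr : 0 ≤ r) (hR : 0 ≤ R) (z : ℂ × ℂ × ℂ)
    (hz : ∀ ζ ∈ sphere (0:ℂ) r ∪ sphere 0 R, ∀ η ∈ sphere (0:ℂ) r ∪ sphere 0 R, (z.1, ζ, η) ∈ Y)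
    (h1 : ‖z.2.1‖ ≠ r) (h2 : ‖z.2.1‖ ≠ R) (h3 : ‖z.2.2‖ ≠ r) (h4 : ‖z.2.2‖ ≠ R) :
    DifferentiableAt ℂ (opF r R f) z := by
  have hK : IsCompact (sphere (0:ℂ) r ∪ sphere 0 R) :=
    (isCompact_sphere _ _).union (isCompact_sphere _ _)
  -- first variable step
  let Y1 : Set ((ℂ × ℂ) × ℂ) := (fun q : (ℂ × ℂ) × ℂ => (q.1.1, q.1.2, q.2)) ⁻¹' Y
  have hY1 : IsOpen Y1 := hY.preimage (by fun_prop)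
  have hf1 : DifferentiableOn ℂ (fun q : (ℂ × ℂ) × ℂ => f (q.1.1, q.1.2, q.2)) Y1 :=
    hf.comp (f := fun q : (ℂ × ℂ) × ℂ => (q.1.1, q.1.2, q.2)) (by fun_prop) (fun q hq => hq)
  let V : Set (ℂ × ℂ × ℂ) := {p | (∀ η ∈ sphere (0:ℂ) r ∪ sphere 0 R, (p.1, p.2.1, η) ∈ Y) ∧
    ‖p.2.2‖ ≠ r ∧ ‖p.2.2‖ ≠ R}
  have hV : IsOpen V := by
    rw [isOpen_iff_mem_nhds]
    rintro p ⟨hp1, hp2, hp3⟩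
    have e1 : ∀ᶠ q in 𝓝 p, ∀ η ∈ sphere (0:ℂ) r ∪ sphere 0 R, (q.1, q.2.1, η) ∈ Y := by
      apply hK.eventually_forall_of_forall_eventually
      intro η hη
      have : Continuous (fun t : (ℂ × ℂ × ℂ) × ℂ => (t.1.1, t.1.2.1, t.2)) := by fun_prop
      exact this.continuousAt.eventually_mem (hY.mem_nhds (hp1 η hη))
    have hc : ContinuousAt (fun q : ℂ × ℂ × ℂ => ‖q.2.2‖) p := by fun_prop
    filter_upwards [e1, hc.eventually_ne hp2, hc.eventually_ne hp3] with q a b c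
    exact ⟨a, b, c⟩
  have hG : DifferentiableOn ℂ (opG r R f) V := by
    rintro p ⟨hp1, hp2, hp3⟩
    apply DifferentiableAt.differentiableWithinAt
    have := aux_opC_diff hY1 hf1 hr hR (p.1, p.2.1) p.2.2 (fun ζ hζ => hp1 ζ (Or.inl hζ))
      (fun ζ hζ => hp1 ζ (Or.inr hζ)) hp2 hp3
    exact DifferentiableAt.comp p (f := fun p : ℂ × ℂ × ℂ => ((p.1, p.2.1), p.2.2)) this
      (by fun_prop)
  let Y2 : Set ((ℂ × ℂ) × ℂ) := (fun q : (ℂ × ℂ) × ℂ => (q.1.1, q.2, q.1.2)) ⁻¹' V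
  have hY2 : IsOpen Y2 := hV.preimage (by fun_prop)
  have hf2 : DifferentiableOn ℂ (fun q : (ℂ × ℂ) × ℂ => opG r R f (q.1.1, q.2, q.1.2)) Y2 :=
    hG.comp (f := fun q : (ℂ × ℂ) × ℂ => (q.1.1, q.2, q.1.2)) (by fun_prop) (fun q hq => hq)
  have := aux_opC_diff hY2 hf2 hr hR (z.1, z.2.2) z.2.1
    (fun ζ hζ => ⟨fun η hη => hz ζ (Or.inl hζ) η hη, h3, h4⟩)
    (fun ζ hζ => ⟨fun η hη => hz ζ (Or.inr hζ) η hη, h3, h4⟩) h1 h2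
  exact DifferentiableAt.comp z (f := fun p : ℂ × ℂ × ℂ => ((p.1, p.2.2), p.2.1)) this
      (by fun_prop)

open Filter Topology Set Metric in
lemma aux_opF_eq {Y : Set (ℂ × ℂ × ℂ)} (hY : IsOpen Y) {f : ℂ × ℂ × ℂ → ℂ}
    (hf : DifferentiableOn ℂ f Y) {r R : ℝ} (hr : 0 < r) (z : ℂ × ℂ × ℂ)
    (hz : ∀ ζ η : ℂ, r ≤ ‖ζ‖ → ‖ζ‖ ≤ R → r ≤ ‖η‖ → ‖η‖ ≤ R → (z.1, ζ, η) ∈ Y)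
    (h1 : r < ‖z.2.1‖) (h2 : ‖z.2.1‖ < R) (h3 : r < ‖z.2.2‖) (h4 : ‖z.2.2‖ < R) :
    opF r R f z = f z := by
  have hR : 0 < R := by linarith
  have hfd : ∀ p ∈ Y, DifferentiableAt ℂ f p := fun p hp =>
    (hf p hp).differentiableAt (hY.mem_nhds hp)
  have hG : ∀ ζ : ℂ, r ≤ ‖ζ‖ → ‖ζ‖ ≤ R → opG r R f (z.1, ζ, z.2.2) = f (z.1, ζ, z.2.2) := by
    intro ζ h5 h6
    unfold opG
    refine aux_opC_eq hr (g := fun η => f (z.1, ζ, η)) ?_ h3 h4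
    intro η h7 h8
    exact DifferentiableAt.comp η (f := fun η : ℂ => (z.1, ζ, η)) (hfd _ (hz ζ η h5 h6 h7 h8))
      (by fun_prop)
  have e : opF r R f z = opC r R (fun ζ => f (z.1, ζ, z.2.2)) z.2.1 := by
    unfold opF opC
    congr 2
    · apply circleIntegral.integral_congr hR.le
      intro ζ hζ
      have : ‖ζ‖ = R := by simpa using hζ
      simp only
      rw [hG ζ (by linarith) (by linarith)]
    · apply circleIntegral.integral_congr hr.le
      intro ζ hζ
      have : ‖ζ‖ = r := by simpa using hζ
      simp only
      rw [hG ζ (by linarith) (by linarith)]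
  rw [e]
  refine aux_opC_eq hr (g := fun ζ => f (z.1, ζ, z.2.2)) ?_ h1 h2
  intro ζ h7 h8
  exact DifferentiableAt.comp ζ (f := fun ζ : ℂ => (z.1, ζ, z.2.2))
    (hfd _ (hz ζ _ h7 h8 h3.le h4.le)) (by fun_prop)

open Filter Topology Set Metric in
lemma aux_glue {c₁ c₂ : ℂ} (h1 : ‖c₁‖ = 1) (h2 : ‖c₂‖ = 1) {H₁ H₂ : ℂ → ℂ}
    (hH1 : ∀ w ∈ ball c₁ 1 ∩ ball c₂ 1, DifferentiableAt ℂ H₁ w)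
    (hH2 : ∀ w ∈ ball c₁ 1 ∩ ball c₂ 1, DifferentiableAt ℂ H₂ w)
    {ε : ℝ} (hε : 0 < ε) (he : ∀ w ∈ ball c₁ 1 ∩ ball c₂ 1, ‖w‖ < ε → H₁ w = H₂ w)
    {z : ℂ} (hz : z ∈ ball c₁ 1 ∩ ball c₂ 1) : H₁ z = H₂ z := by
  have ho : IsOpen (ball c₁ 1 ∩ ball c₂ 1) := isOpen_ball.inter isOpen_ball
  have hc : IsPreconnected (ball c₁ 1 ∩ ball c₂ 1) :=
    ((convex_ball c₁ 1).inter (convex_ball c₂ 1)).isPreconnected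
  have a1 : AnalyticOnNhd ℂ H₁ (ball c₁ 1 ∩ ball c₂ 1) :=
    DifferentiableOn.analyticOnNhd (fun w hw => (hH1 w hw).differentiableWithinAt) ho
  have a2 : AnalyticOnNhd ℂ H₂ (ball c₁ 1 ∩ ball c₂ 1) :=
    DifferentiableOn.analyticOnNhd (fun w hw => (hH2 w hw).differentiableWithinAt) ho
  obtain ⟨τ, hτ0, hτ1, hτ⟩ : ∃ τ : ℝ, 0 < τ ∧ τ ≤ 1 ∧ τ * ‖z‖ < ε := by
    refine ⟨min 1 (ε / (‖z‖ + 1)), by positivity, min_le_left _ _, ?_⟩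
    have h3 : min 1 (ε / (‖z‖ + 1)) * ‖z‖ ≤ ε / (‖z‖ + 1) * ‖z‖ := by
      gcongr; exact min_le_right _ _
    refine h3.trans_lt ?_
    rw [div_mul_eq_mul_div, div_lt_iff₀ (by positivity)]
    nlinarith
  have hin : ∀ c : ℂ, ‖c‖ = 1 → z ∈ ball c 1 → (τ : ℂ) * z ∈ ball c 1 := by
    intro c hc hzc
    rw [mem_ball, dist_eq_norm] at hzc ⊢
    have : (τ : ℂ) * z - c = (τ : ℂ) * (z - c) + ((1 - τ : ℝ) : ℂ) * (-c) := by
      push_cast; ring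
    rw [this]
    refine (norm_add_le _ _).trans_lt ?_
    rw [norm_mul, norm_mul, norm_neg, hc, Complex.norm_real, Complex.norm_real,
      Real.norm_of_nonneg hτ0.le, Real.norm_of_nonneg (by linarith)]
    nlinarith
  have hw : (τ : ℂ) * z ∈ ball c₁ 1 ∩ ball c₂ 1 := ⟨hin _ h1 hz.1, hin _ h2 hz.2⟩
  have hwn : ‖(τ : ℂ) * z‖ < ε := by
    rwa [norm_mul, Complex.norm_real, Real.norm_of_nonneg hτ0.le]
  refine a1.eqOn_of_preconnected_of_eventuallyEq a2 hc hw ?_ hz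
  have hcn : ContinuousAt (fun w : ℂ => ‖w‖) ((τ : ℂ) * z) := by fun_prop
  filter_upwards [ho.mem_nhds hw, hcn.eventually_lt_const hwn] with w b1 b2 using he w b1 b2

lemma aux_log_lt {w : ℂ} (hw : w ≠ 0) (c : ℝ) :
    c < Real.log (‖w‖ ^ 2) ↔ Real.exp (c / 2) < ‖w‖ := by
  rw [Real.log_pow, ← Real.lt_log_iff_exp_lt (norm_pos_iff.2 hw)]
  push_cast
  constructor <;> intro h <;> linarith

lemma aux_lt_log {w : ℂ} (hw : w ≠ 0) (c : ℝ) :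
    Real.log (‖w‖ ^ 2) < c ↔ ‖w‖ < Real.exp (c / 2) := by
  rw [Real.log_pow, ← Real.log_lt_iff_lt_exp (norm_pos_iff.2 hw)]
  push_cast
  constructor <;> intro h <;> linarith

lemma aux_L (z : ℂ × ℂ × ℂ) (h1 : z.2.1 ≠ 0) (h2 : z.2.2 ≠ 0) :
    Lofz z = Real.log (‖z.2.1‖ ^ 2) + Real.log (‖z.2.2‖ ^ 2) := by
  unfold Lofz
  rw [norm_mul, mul_pow, Real.log_mul] <;> simpa

lemma aux_closure {μ : ℝ} (z : ℂ × ℂ × ℂ) (h1 : z.2.1 ≠ 0) (h2 : z.2.2 ≠ 0)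
    (h3 : ‖z.1 - Complex.exp (Complex.I * (Lofz z : ℂ))‖ ≤ 1)
    (h4 : -μ < Real.log (‖z.2.1‖ ^ 2)) (h5 : Real.log (‖z.2.1‖ ^ 2) < μ)
    (h6 : -μ < Real.log (‖z.2.2‖ ^ 2)) (h7 : Real.log (‖z.2.2‖ ^ 2) < μ) :
    z ∈ closure (wormTrunc μ) := by
  have hz : z.1 ∈ closure (Metric.ball (Complex.exp (Complex.I * (Lofz z : ℂ))) 1) := by
    rw [closure_ball _ one_ne_zero]
    simpa [dist_eq_norm] using h3
  refine map_mem_closure (f := fun w : ℂ => (w, z.2.1, z.2.2)) (by fun_prop) hz ?_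
  intro w hw
  refine ⟨h1, h2, ?_, h4, h5, h6, h7⟩
  rw [Metric.mem_ball, dist_eq_norm] at hw
  exact hw

open Filter Topology in
lemma aux_trunc_open (μ : ℝ) : IsOpen (wormTrunc μ) := by
  rw [isOpen_iff_mem_nhds]
  rintro z ⟨h1, h2, h3, h4, h5, h6, h7⟩
  have c1 : ContinuousAt (fun z : ℂ × ℂ × ℂ => Real.log (‖z.2.1‖ ^ 2)) z :=
    ContinuousAt.log (by fun_prop) (by simpa using h1)
  have c2 : ContinuousAt (fun z : ℂ × ℂ × ℂ => Real.log (‖z.2.2‖ ^ 2)) z :=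
    ContinuousAt.log (by fun_prop) (by simpa using h2)
  have c3 : ContinuousAt (fun z : ℂ × ℂ × ℂ => Lofz z) z :=
    ContinuousAt.log (by fun_prop) (by simp [h1, h2])
  have c4 : ContinuousAt
      (fun z : ℂ × ℂ × ℂ => ‖z.1 - Complex.exp (Complex.I * (Lofz z : ℂ))‖) z := by
    fun_prop
  have c5 : ContinuousAt (fun z : ℂ × ℂ × ℂ => z.2.1) z := by fun_prop
  have c6 : ContinuousAt (fun z : ℂ × ℂ × ℂ => z.2.2) z := by fun_prop
  filter_upwards [c5.eventually_ne h1, c6.eventually_ne h2, c4.eventually_lt_const h3,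
    c1.eventually_const_lt h4, c1.eventually_lt_const h5, c2.eventually_const_lt h6,
    c2.eventually_lt_const h7] with p a1 a2 a3 a4 a5 a6 a7
  exact ⟨a1, a2, a3, a4, a5, a6, a7⟩

/-- The added pieces, in terms of norms. -/
def pieceB (a : ℝ) : Set (ℂ × ℂ × ℂ) :=
  {z | ‖z.1 - Complex.exp (2 * Complex.I * (a : ℂ))‖ < 1 ∧
    Real.exp (a / 2) < ‖z.2.1‖ ∧ ‖z.2.1‖ < Real.exp ((a + 2 * Real.pi) / 2) ∧
    Real.exp (a / 2) < ‖z.2.2‖ ∧ ‖z.2.2‖ < Real.exp ((a + 2 * Real.pi) / 2)}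

lemma aux_piece_open (a : ℝ) : IsOpen (pieceB a) := by
  unfold pieceB
  simp only [Set.ofPred_and]
  refine IsOpen.inter (isOpen_lt (by fun_prop) (by fun_prop)) (IsOpen.inter
    (isOpen_lt (by fun_prop) (by fun_prop)) (IsOpen.inter (isOpen_lt (by fun_prop) (by fun_prop))
    (IsOpen.inter (isOpen_lt (by fun_prop) (by fun_prop))
      (isOpen_lt (by fun_prop) (by fun_prop)))))

/-- The local extension on a piece. -/
noncomputable def extA (f : ℂ × ℂ × ℂ → ℂ) (a : ℝ) : ℂ × ℂ × ℂ → ℂ :=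
  opF (Real.exp (a / 2)) (Real.exp ((a + 2 * Real.pi) / 2)) f

open Metric in
lemma aux_log_sphere {a : ℝ} {ζ : ℂ} (h : ζ ∈ sphere (0:ℂ) (Real.exp (a / 2)) ∪
    sphere 0 (Real.exp ((a + 2 * Real.pi) / 2))) :
    ζ ≠ 0 ∧ (Real.log (‖ζ‖ ^ 2) = a ∨ Real.log (‖ζ‖ ^ 2) = a + 2 * Real.pi) := by
  have key : ∀ b : ℝ, ‖ζ‖ = Real.exp (b / 2) → ζ ≠ 0 ∧ Real.log (‖ζ‖ ^ 2) = b := by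
    intro b hb
    refine ⟨norm_pos_iff.1 (hb ▸ Real.exp_pos _), ?_⟩
    rw [hb, Real.log_pow, Real.log_exp]; push_cast; ring
  rcases h with h | h
  · obtain ⟨h1, h2⟩ := key a (by simpa using h)
    exact ⟨h1, Or.inl h2⟩
  · obtain ⟨h1, h2⟩ := key (a + 2 * Real.pi) (by simpa using h)
    exact ⟨h1, Or.inr h2⟩

open Metric in
lemma aux_extA_diff {μ : ℝ} {Y : Set (ℂ × ℂ × ℂ)} (hY : IsOpen Y)
    (hYW : closure (wormTrunc μ) ⊆ Y) {f : ℂ × ℂ × ℂ → ℂ} (hf : DifferentiableOn ℂ f Y)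
    {a : ℝ} (ha : a ∈ Set.Ioo (-μ / 2) (μ / 2 - 2 * Real.pi)) {z : ℂ × ℂ × ℂ} (hz : z ∈ pieceB a) :
    DifferentiableAt ℂ (extA f a) z := by
  obtain ⟨h0, h1, h2, h3, h4⟩ := hz
  obtain ⟨ha1, ha2⟩ := ha
  have hpi := Real.pi_pos
  refine aux_opF_diff hY hf (Real.exp_pos _).le (Real.exp_pos _).le z ?_ h1.ne' h2.ne h3.ne' h4.ne
  intro ζ hζ η hη
  obtain ⟨hζ0, hζ⟩ := aux_log_sphere hζ
  obtain ⟨hη0, hη⟩ := aux_log_sphere hη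
  apply hYW
  have hL := aux_L (z.1, ζ, η) hζ0 hη0
  have hexp : Complex.exp (Complex.I * (Lofz (z.1, ζ, η) : ℂ)) =
      Complex.exp (2 * Complex.I * (a : ℂ)) := by
    rw [Complex.exp_eq_exp_iff_exists_int, hL]
    rcases hζ with hζ | hζ <;> rcases hη with hη | hη <;> simp only [hζ, hη]
    · exact ⟨0, by push_cast; ring⟩
    · exact ⟨1, by push_cast; ring⟩
    · exact ⟨1, by push_cast; ring⟩
    · exact ⟨2, by push_cast; ring⟩
  refine aux_closure _ hζ0 hη0 (by rw [hexp]; exact h0.le) ?_ ?_ ?_ ?_ <;>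
  rcases hζ with hζ | hζ <;> rcases hη with hη | hη <;> simp only [hζ, hη] <;> linarith

open Metric Set in
lemma aux_extA_eq {μ : ℝ} {Y : Set (ℂ × ℂ × ℂ)} (hY : IsOpen Y)
    (hYW : closure (wormTrunc μ) ⊆ Y) {f : ℂ × ℂ × ℂ → ℂ} (hf : DifferentiableOn ℂ f Y)
    {a : ℝ} (ha : a ∈ Set.Ioo (-μ / 2) (μ / 2 - 2 * Real.pi)) :
    ∃ ε > 0, ∀ z ∈ pieceB a, ‖z.1‖ < ε → extA f a z = f z := by
  obtain ⟨ha1, ha2⟩ := ha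
  have hpi := Real.pi_pos
  set r := Real.exp (a / 2) with hr
  set R := Real.exp ((a + 2 * Real.pi) / 2) with hR
  have hr0 : 0 < r := Real.exp_pos _
  let A : Set ℂ := closedBall 0 R ∩ {w | r ≤ ‖w‖}
  have hA : IsCompact A := (isCompact_closedBall _ _).inter_right
    (isClosed_le continuous_const continuous_norm)
  have hlog : ∀ w ∈ A, w ≠ 0 ∧ -μ < Real.log (‖w‖ ^ 2) ∧ Real.log (‖w‖ ^ 2) < μ := by
    rintro w ⟨hw1, hw2⟩
    simp only [mem_closedBall_zero_iff, mem_ofPred_eq] at hw1 hw2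
    have hw0 : w ≠ 0 := norm_pos_iff.1 (hr0.trans_le hw2)
    refine ⟨hw0, ?_, ?_⟩
    · rw [aux_log_lt hw0]
      refine lt_of_lt_of_le (Real.exp_lt_exp.2 ?_) hw2
      linarith
    · rw [aux_lt_log hw0]
      refine lt_of_le_of_lt hw1 (Real.exp_lt_exp.2 ?_)
      linarith
  obtain ⟨u, v, hu, hv, hxu, hKv, huv⟩ := generalized_tube_lemma
    (isCompact_singleton (x := (0:ℂ))) (hA.prod hA) hY (by
      rintro ⟨z1, z2, z3⟩ ⟨h1, h2, h3⟩
      simp only [mem_singleton_iff] at h1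
      subst h1
      obtain ⟨a1, a2, a3⟩ := hlog _ h2
      obtain ⟨b1, b2, b3⟩ := hlog _ h3
      apply hYW
      refine aux_closure _ a1 b1 ?_ a2 a3 b2 b3
      rw [zero_sub, norm_neg, mul_comm, Complex.norm_exp_ofReal_mul_I])
  obtain ⟨ε, hε, hεu⟩ := Metric.isOpen_iff.1 hu 0 (hxu rfl)
  refine ⟨ε, hε, ?_⟩
  rintro z ⟨h0, h1, h2, h3, h4⟩ hz
  refine aux_opF_eq hY hf hr0 z ?_ h1 h2 h3 h4
  intro ζ η k1 k2 k3 k4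
  refine huv ⟨hεu (by simpa using hz), hKv ⟨⟨by simpa using k2, k1⟩, ⟨by simpa using k4, k3⟩⟩⟩

open Metric Set in
lemma aux_diff_slice {f : ℂ × ℂ × ℂ → ℂ} {w z2 z3 : ℂ} (h : DifferentiableAt ℂ f (w, z2, z3)) :
    DifferentiableAt ℂ (fun w => f (w, z2, z3)) w :=
  DifferentiableAt.comp w (f := fun w : ℂ => (w, z2, z3)) h (by fun_prop)

lemma aux_norm_exp (a : ℝ) : ‖Complex.exp (2 * Complex.I * (a : ℂ))‖ = 1 := by
  have : (2 * Complex.I * (a : ℂ)) = ((2 * a : ℝ) : ℂ) * Complex.I := by push_cast; ring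
  rw [this, Complex.norm_exp_ofReal_mul_I]

lemma aux_compat {μ : ℝ} {Y : Set (ℂ × ℂ × ℂ)} (hY : IsOpen Y)
    (hYW : closure (wormTrunc μ) ⊆ Y) {f : ℂ × ℂ × ℂ → ℂ} (hf : DifferentiableOn ℂ f Y)
    {a b : ℝ} (ha : a ∈ Set.Ioo (-μ / 2) (μ / 2 - 2 * Real.pi))
    (hb : b ∈ Set.Ioo (-μ / 2) (μ / 2 - 2 * Real.pi)) {z : ℂ × ℂ × ℂ} (hza : z ∈ pieceB a)
    (hzb : z ∈ pieceB b) : extA f a z = extA f b z := by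
  obtain ⟨ε, hε, he⟩ := aux_extA_eq hY hYW hf ha
  obtain ⟨δ, hδ, hd⟩ := aux_extA_eq hY hYW hf hb
  have ma : ∀ w ∈ Metric.ball (Complex.exp (2 * Complex.I * (a : ℂ))) 1,
      (w, z.2.1, z.2.2) ∈ pieceB a := by
    intro w hw
    rw [Metric.mem_ball, dist_eq_norm] at hw
    exact ⟨hw, hza.2⟩
  have mb : ∀ w ∈ Metric.ball (Complex.exp (2 * Complex.I * (b : ℂ))) 1,
      (w, z.2.1, z.2.2) ∈ pieceB b := by
    intro w hw
    rw [Metric.mem_ball, dist_eq_norm] at hw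
    exact ⟨hw, hzb.2⟩
  refine aux_glue (aux_norm_exp a) (aux_norm_exp b)
    (H₁ := fun w => extA f a (w, z.2.1, z.2.2)) (H₂ := fun w => extA f b (w, z.2.1, z.2.2))
    (fun w hw => aux_diff_slice (aux_extA_diff hY hYW hf ha (ma w hw.1)))
    (fun w hw => aux_diff_slice (aux_extA_diff hY hYW hf hb (mb w hw.2)))
    (ε := min ε δ) (lt_min hε hδ) ?_ (z := z.1) ?_
  · intro w hw hn
    rw [he _ (ma w hw.1) (hn.trans_le (min_le_left _ _)),
      hd _ (mb w hw.2) (hn.trans_le (min_le_right _ _))]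
  · simp only [Set.mem_inter_iff, Metric.mem_ball, dist_eq_norm]
    exact ⟨hza.1, hzb.1⟩

lemma aux_compat_f {μ : ℝ} {Y : Set (ℂ × ℂ × ℂ)} (hY : IsOpen Y)
    (hYW : closure (wormTrunc μ) ⊆ Y) {f : ℂ × ℂ × ℂ → ℂ} (hf : DifferentiableOn ℂ f Y)
    {a : ℝ} (ha : a ∈ Set.Ioo (-μ / 2) (μ / 2 - 2 * Real.pi)) {z : ℂ × ℂ × ℂ} (hza : z ∈ pieceB a)
    (hz : z ∈ wormTrunc μ) : extA f a z = f z := by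
  obtain ⟨ε, hε, he⟩ := aux_extA_eq hY hYW hf ha
  have ma : ∀ w ∈ Metric.ball (Complex.exp (2 * Complex.I * (a : ℂ))) 1,
      (w, z.2.1, z.2.2) ∈ pieceB a := by
    intro w hw
    rw [Metric.mem_ball, dist_eq_norm] at hw
    exact ⟨hw, hza.2⟩
  have mb : ∀ w ∈ Metric.ball (Complex.exp (Complex.I * (Lofz z : ℂ))) 1,
      (w, z.2.1, z.2.2) ∈ wormTrunc μ := by
    intro w hw
    rw [Metric.mem_ball, dist_eq_norm] at hw
    exact ⟨hz.1, hz.2.1, hw, hz.2.2.2⟩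
  refine aux_glue (aux_norm_exp a) (c₂ := Complex.exp (Complex.I * (Lofz z : ℂ)))
    (by rw [mul_comm, Complex.norm_exp_ofReal_mul_I])
    (H₁ := fun w => extA f a (w, z.2.1, z.2.2)) (H₂ := fun w => f (w, z.2.1, z.2.2))
    (fun w hw => aux_diff_slice (aux_extA_diff hY hYW hf ha (ma w hw.1)))
    (fun w hw => aux_diff_slice ?_) (ε := ε) hε ?_ (z := z.1) ?_
  · have := hYW (subset_closure (mb w hw.2))
    exact (hf _ this).differentiableAt (hY.mem_nhds this)
  · intro w hw hn
    exact he _ (ma w hw.1) hn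
  · simp only [Set.mem_inter_iff, Metric.mem_ball, dist_eq_norm]
    exact ⟨hza.1, hz.2.2.1⟩

/-- Every function holomorphic on a neighborhood of the closure of `W'_μ` extends
holomorphically to `Ŵ'_μ` (for `μ > 4π`). -/
theorem extension_from_nbhd_of_closure (μ : ℝ) (hμ : 4 * Real.pi < μ)
    (Y : Set (ℂ × ℂ × ℂ)) (hY : IsOpen Y) (hYW : closure (wormTrunc μ) ⊆ Y)
    (f : ℂ × ℂ × ℂ → ℂ) (hf : DifferentiableOn ℂ f Y) :
    ∃ F : ℂ × ℂ × ℂ → ℂ, DifferentiableOn ℂ F (wormHat μ) ∧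
      Set.EqOn F f (wormTrunc μ) := by
  classical
  let F : ℂ × ℂ × ℂ → ℂ := fun z =>
    if z ∈ wormTrunc μ then f z else
      if h : ∃ a ∈ Set.Ioo (-μ / 2) (μ / 2 - 2 * Real.pi), z ∈ pieceB a then
        extA f h.choose z else 0
  have hF1 : ∀ z ∈ wormTrunc μ, F z = f z := fun z hz => if_pos hz
  have hF2 : ∀ a ∈ Set.Ioo (-μ / 2) (μ / 2 - 2 * Real.pi), ∀ z ∈ pieceB a,
      F z = extA f a z := by
    intro a ha z hz
    by_cases hW : z ∈ wormTrunc μ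
    · rw [hF1 z hW, aux_compat_f hY hYW hf ha hz hW]
    · have h : ∃ a ∈ Set.Ioo (-μ / 2) (μ / 2 - 2 * Real.pi), z ∈ pieceB a := ⟨a, ha, hz⟩
      simp only [F, if_neg hW, dif_pos h]
      exact aux_compat hY hYW hf h.choose_spec.1 ha h.choose_spec.2 hz
  refine ⟨F, ?_, hF1⟩
  rintro z (hz | hz)
  · apply DifferentiableAt.differentiableWithinAt
    have hzY := hYW (subset_closure hz)
    refine ((hf _ hzY).differentiableAt (hY.mem_nhds hzY)).congr_of_eventuallyEq ?_
    filter_upwards [(aux_trunc_open μ).mem_nhds hz] with w hw using hF1 w hw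
  · simp only [Set.mem_iUnion] at hz
    obtain ⟨a, ha, h0, h1, h2, h3, h4, h5, h6⟩ := hz
    have hzB : z ∈ pieceB a := ⟨h0, (aux_log_lt h1 _).1 h2, (aux_lt_log h1 _).1 h3,
      (aux_log_lt h4 _).1 h5, (aux_lt_log h4 _).1 h6⟩
    apply DifferentiableAt.differentiableWithinAt
    refine (aux_extA_diff hY hYW hf ha hzB).congr_of_eventuallyEq ?_
    filter_upwards [(aux_piece_open a).mem_nhds hzB] with w hw using hF2 a ha w hw
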